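/- arXiv:1010.3674 — 14 statements merged into one kernel-verified Lean document; each statement's English description precedes it below -/
import Mathlib

section
/- In any CP-algebra, left-sequential conjunction is associative: for all x, y, z, (x ∧· y) ∧· z = x ∧· (y ∧· z). -/
/-- A CP-algebra: a type with constants `T`, `F` and Hoare's ternary conditional
`cond x y z` (written `x ◁ y ▷ z`) satisfying axioms (CP1)–(CP4). -/
structure CPAlg (M : Type*) where
  T : M
  F : M
  cond : M → M → M → M
  cp1 : ∀ x y, cond x T y = x
  cp2 : ∀ x y, cond x F y = y
  cp3 : ∀ x, cond T x F = x
  cp4 : ∀ x y z u v, cond x (cond y z u) v = cond (cond x y v) z (cond x u v)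

namespace CPAlg
variable {M : Type*}
/-- Negation: `¬x = F ◁ x ▷ T`. -/
def neg (A : CPAlg M) (x : M) : M := A.cond A.F x A.T
/-- Left-sequential conjunction: `x ∧· y = y ◁ x ▷ F`. -/
def sand (A : CPAlg M) (x y : M) : M := A.cond y x A.F
/-- Left-sequential disjunction: `x ∨· y = ¬(¬x ∧· ¬y)`. -/
def sor (A : CPAlg M) (x y : M) : M := A.neg (A.sand (A.neg x) (A.neg y))
end CPAlg

/-- Left-sequential conjunction is associative. -/
theorem CPAlg.sand_assoc {M : Type*} (A : CPAlg M) (x y z : M) :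
    A.sand (A.sand x y) z = A.sand x (A.sand y z) := by
  simp only [sand, cp4, cp2]
end

section
/- In any CP-algebra, the equation (SCL8) holds: for all x, y, z, (x ∨· y) ∧· (z ∧· F) = (¬x ∨· (z ∧· F)) ∧· (y ∧· (z ∧· F)). -/
/-- (SCL8): `(x ∨· y) ∧· (z ∧· F) = (¬x ∨· (z ∧· F)) ∧· (y ∧· (z ∧· F))`. -/
theorem CPAlg.scl8 {M : Type*} (A : CPAlg M) (x y z : M) :
    A.sand (A.sor x y) (A.sand z A.F) =
      A.sand (A.sor (A.neg x) (A.sand z A.F)) (A.sand y (A.sand z A.F)) := by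
  simp only [CPAlg.sand, CPAlg.sor, CPAlg.neg, A.cp1, A.cp2, A.cp4]
end

section
/- In any CP-algebra, the restricted right-distributivity law (SCL9) holds: for all x, y, z, (x ∨· y) ∧· (z ∨· T) = (x ∧· (z ∨· T)) ∨· (y ∧· (z ∨· T)). -/
/-- Disjunction in terms of the conditional: `x ∨· y = T ◁ x ▷ y`. -/
theorem CPAlg.sor_eq_cond {M : Type*} (A : CPAlg M) (x y : M) :
    A.sor x y = A.cond A.T x y := by
  simp only [CPAlg.sor, CPAlg.sand, CPAlg.neg, A.cp1, A.cp2, A.cp3, A.cp4]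

/-- (SCL9): `(x ∨· y) ∧· (z ∨· T) = (x ∧· (z ∨· T)) ∨· (y ∧· (z ∨· T))`. -/
theorem CPAlg.scl9 {M : Type*} (A : CPAlg M) (x y z : M) :
    A.sand (A.sor x y) (A.sor z A.T) =
      A.sor (A.sand x (A.sor z A.T)) (A.sand y (A.sor z A.T)) := by
  simp only [CPAlg.sor_eq_cond, CPAlg.sand, A.cp1, A.cp2, A.cp4]
end

section
/- In any CP-algebra, the restricted right-distributivity law (SCL10) holds: for all x, y, z, ((x ∧· F) ∨· y) ∧· z = (x ∧· F) ∨· (y ∧· z). -/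
/-- (SCL10): `((x ∧· F) ∨· y) ∧· z = (x ∧· F) ∨· (y ∧· z)`. -/
theorem CPAlg.scl10 {M : Type*} (A : CPAlg M) (x y z : M) :
    A.sand (A.sor (A.sand x A.F) y) z =
      A.sor (A.sand x A.F) (A.sand y z) := by
  simp only [sand, sor, neg, A.cp1, A.cp2, A.cp3, A.cp4]
end

section
/- In any EqFSCL-algebra, the following consequences hold for all x, y: x ∧· F = ¬x ∧· F; (x ∨· y) ∧· F = ¬x ∧· (y ∧· F); and (x ∨· T) ∧· y = (x ∧· F) ∨· y. -/
/-- The signature of short-circuit logic: a constant `T`, negation `neg`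
and left-sequential conjunction `sand` (written `x ∧· y`). -/
structure SCLSig (M : Type*) where
  T : M
  neg : M → M
  sand : M → M → M

namespace SCLSig
variable {M : Type*}
/-- `F` is defined as `¬T`. -/
def F (A : SCLSig M) : M := A.neg A.T
/-- Left-sequential disjunction: `x ∨· y = ¬(¬x ∧· ¬y)`. -/
def sor (A : SCLSig M) (x y : M) : M := A.neg (A.sand (A.neg x) (A.neg y))
end SCLSig

/-- An EqFSCL-algebra: an SCL signature satisfying (SCL3)–(SCL10), where
`F = ¬T` and `x ∨· y = ¬(¬x ∧· ¬y)`. -/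
structure EqFSCL (M : Type*) extends SCLSig M where
  scl3 : ∀ x, neg (neg x) = x
  scl4 : ∀ x, sand T x = x
  scl5 : ∀ x, sand x T = x
  scl6 : ∀ x, sand toSCLSig.F x = toSCLSig.F
  scl7 : ∀ x y z, sand (sand x y) z = sand x (sand y z)
  scl8 : ∀ x y z, sand (toSCLSig.sor x y) (sand z toSCLSig.F) =
    sand (toSCLSig.sor (neg x) (sand z toSCLSig.F)) (sand y (sand z toSCLSig.F))
  scl9 : ∀ x y z, sand (toSCLSig.sor x y) (toSCLSig.sor z T) =
    toSCLSig.sor (sand x (toSCLSig.sor z T)) (sand y (toSCLSig.sor z T))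
  scl10 : ∀ x y z, sand (toSCLSig.sor (sand x toSCLSig.F) y) z =
    toSCLSig.sor (sand x toSCLSig.F) (sand y z)

namespace EqFSCL
variable {M : Type*} (A : EqFSCL M)

lemma neg_F : A.neg A.F = A.T := A.scl3 A.T

lemma sor_F (x : M) : A.sor x A.F = x := by
  rw [SCLSig.sor, neg_F, A.scl5, A.scl3]

lemma sor_sand_F (x y : M) : A.sand (A.sor x y) A.F = A.sand (A.neg x) (A.sand y A.F) := by
  simpa only [A.scl4, sor_F] using A.scl8 x y A.T

lemma sand_F_eq_neg_sand_F (x : M) : A.sand x A.F = A.sand (A.neg x) A.F := by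
  simpa only [sor_F, A.scl6] using A.sor_sand_F x A.F

lemma sor_T (x : M) : A.sor x A.T = A.neg (A.sand (A.neg x) A.F) := rfl

lemma sand_F_sor_T (x : M) : A.sor (A.sand x A.F) A.T = A.sor x A.T := by
  rw [sor_T, sor_T, ← sand_F_eq_neg_sand_F, ← sand_F_eq_neg_sand_F, A.scl7, A.scl6]

lemma sor_T_sand (x y : M) : A.sand (A.sor x A.T) y = A.sor (A.sand x A.F) y := by
  rw [← sand_F_sor_T, A.scl10, A.scl4]

end EqFSCL

/-- In any EqFSCL-algebra: `x ∧· F = ¬x ∧· F`; `(x ∨· y) ∧· F = ¬x ∧· (y ∧· F)`;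
and `(x ∨· T) ∧· y = (x ∧· F) ∨· y`. -/
theorem EqFSCL.consequences {M : Type*} (A : EqFSCL M) (x y : M) :
    A.sand x A.F = A.sand (A.neg x) A.F ∧
    A.sand (A.sor x y) A.F = A.sand (A.neg x) (A.sand y A.F) ∧
    A.sand (A.sor x A.T) y = A.sor (A.sand x A.F) y :=
  ⟨A.sand_F_eq_neg_sand_F x, A.sor_sand_F x y, A.sor_T_sand x y⟩
end

section
/- In any CPmem-algebra, the contraction laws hold: for all x, y, v, w, x ◁ y ▷ (v ◁ y ▷ w) = x ◁ y ▷ w and (w ◁ y ▷ v) ◁ y ▷ x = w ◁ y ▷ x. -/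
/-- A CPmem-algebra: a type with constants `T`, `F` and Hoare's ternary conditional
`cond x y z` (written `x ◁ y ▷ z`) satisfying (CP1)–(CP4) and (CPmem). -/
structure CPmemAlg (M : Type*) where
  T : M
  F : M
  cond : M → M → M → M
  cp1 : ∀ x y, cond x T y = x
  cp2 : ∀ x y, cond x F y = y
  cp3 : ∀ x, cond T x F = x
  cp4 : ∀ x y z u v, cond x (cond y z u) v = cond (cond x y v) z (cond x u v)
  cpmem : ∀ x y z u v w,
    cond x y (cond z u (cond v y w)) = cond x y (cond z u w)

namespace CPmemAlg
variable {M : Type*}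
/-- Negation: `¬x = F ◁ x ▷ T`. -/
def neg (A : CPmemAlg M) (x : M) : M := A.cond A.F x A.T
/-- Left-sequential conjunction: `x ∧· y = y ◁ x ▷ F`. -/
def sand (A : CPmemAlg M) (x y : M) : M := A.cond y x A.F
/-- Left-sequential disjunction: `x ∨· y = ¬(¬x ∧· ¬y)`. -/
def sor (A : CPmemAlg M) (x y : M) : M := A.neg (A.sand (A.neg x) (A.neg y))
end CPmemAlg

namespace CPmemAlg

theorem cond_neg {M : Type*} (A : CPmemAlg M) (x y z : M) :
    A.cond x (A.neg y) z = A.cond z y x := by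
  rw [neg, A.cp4, A.cp2, A.cp1]

theorem cond_cond_right {M : Type*} (A : CPmemAlg M) (x y v w : M) :
    A.cond x y (A.cond v y w) = A.cond x y w := by
  simpa only [A.cp2] using A.cpmem x y x A.F v w

end CPmemAlg

/-- Contraction laws in CPmem: `x ◁ y ▷ (v ◁ y ▷ w) = x ◁ y ▷ w` and
`(w ◁ y ▷ v) ◁ y ▷ x = w ◁ y ▷ x`. -/
theorem CPmemAlg.contraction {M : Type*} (A : CPmemAlg M) (x y v w : M) :
    A.cond x y (A.cond v y w) = A.cond x y w ∧
    A.cond (A.cond w y v) y x = A.cond w y x := by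
  refine ⟨A.cond_cond_right x y v w, ?_⟩
  simpa only [A.cond_neg] using A.cond_cond_right x (A.neg y) v w
end

section
/- In any CPmem-algebra, left-sequential conjunction is idempotent: for all x, x ∧· x = x. -/
/-- Negating the condition swaps the two branches. -/
theorem CPmemAlg.cond_neg_s9 {M : Type*} (A : CPmemAlg M) (x y z : M) :
    A.cond x (A.neg y) z = A.cond z y x := by
  rw [CPmemAlg.neg, A.cp4, A.cp1, A.cp2]

/-- A repeated condition in the right branch can be dropped. -/
theorem CPmemAlg.cond_cond_right_s9 {M : Type*} (A : CPmemAlg M) (x y v w : M) :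
    A.cond x y (A.cond v y w) = A.cond x y w := by
  simpa only [A.cp2] using A.cpmem x y A.T A.F v w

/-- A repeated condition in the left branch can be dropped. -/
theorem CPmemAlg.cond_cond_left {M : Type*} (A : CPmemAlg M) (x y v w : M) :
    A.cond (A.cond v y w) y x = A.cond v y x := by
  simpa only [A.cond_neg_s9] using A.cond_cond_right_s9 x (A.neg y) w v

/-- In any CPmem-algebra, left-sequential conjunction is idempotent. -/
theorem CPmemAlg.sand_idem {M : Type*} (A : CPmemAlg M) (x : M) :
    A.sand x x = x := by
  simpa only [CPmemAlg.sand, A.cp3] using A.cond_cond_left A.F x A.T A.F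
end

section
/- In any CPmem-algebra, the conditional is definable from negation and the sequential connectives: for all x, y, z, (y ∧· x) ∨· (¬y ∧· z) = x ◁ y ▷ z. -/
namespace CPmemAlg

theorem neg_neg {M : Type*} (A : CPmemAlg M) (x : M) : A.neg (A.neg x) = x := by
  simp only [neg, A.cp4, A.cp1, A.cp2, A.cp3]

theorem neg_cond {M : Type*} (A : CPmemAlg M) (x y z : M) :
    A.neg (A.cond x y z) = A.cond (A.neg x) y (A.neg z) :=
  A.cp4 ..

/-- Disjunction as a conditional: `x ∨· y = T ◁ x ▷ y`. -/
theorem sor_eq_cond {M : Type*} (A : CPmemAlg M) (x y : M) :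
    A.sor x y = A.cond A.T x y := by
  rw [sor, sand, cond_neg, neg_cond, neg_neg, neg, A.cp2]

/-- The mirror image of the memorizing axiom: the test of `y` is remembered when `y` was true. -/
theorem cond_cond_left_s10 {M : Type*} (A : CPmemAlg M) (x y z u v w : M) :
    A.cond (A.cond z u (A.cond v y w)) y x = A.cond (A.cond z u v) y x := by
  simpa only [cond_neg] using A.cpmem x (A.neg y) z u w v

end CPmemAlg

/-- In any CPmem-algebra the conditional is definable from the sequential
connectives: `(y ∧· x) ∨· (¬y ∧· z) = x ◁ y ▷ z`. -/
theorem CPmemAlg.cond_def {M : Type*} (A : CPmemAlg M) (x y z : M) :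
    A.sor (A.sand y x) (A.sand (A.neg y) z) = A.cond x y z := by
  rw [sor_eq_cond, sand, sand, cond_neg, A.cp4, A.cp2, cond_cond_right, cond_cond_left_s10, A.cp3]
end

section
/- In any EqMSCL-algebra, for all x, y: x ∧· ¬x = x ∧· F, and x ∧· y = x ∧· (¬x ∨· y). -/
/-- An EqMSCL-algebra: an SCL signature (with `F = ¬T` and
`x ∨· y = ¬(¬x ∧· ¬y)`) satisfying the EqMSCL axioms. -/
structure EqMSCL (M : Type*) extends SCLSig M where
  neg_neg : ∀ x, neg (neg x) = x
  T_sand : ∀ x, sand T x = x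
  sand_T : ∀ x, sand x T = x
  F_sand : ∀ x, sand toSCLSig.F x = toSCLSig.F
  sand_assoc : ∀ x y z, sand (sand x y) z = sand x (sand y z)
  sand_F : ∀ x, sand x toSCLSig.F = sand (neg x) toSCLSig.F
  mscl1 : ∀ x y, sand x (toSCLSig.sor x y) = x
  mscl2 : ∀ x y z, sand x (toSCLSig.sor y z) =
    toSCLSig.sor (sand x y) (sand x z)
  mscl3 : ∀ x y z, sand (toSCLSig.sor x y) (toSCLSig.sor (neg x) z) =
    sand (toSCLSig.sor (neg x) z) (toSCLSig.sor x y)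
  mscl4 : ∀ x y z u,
    sand (toSCLSig.sor (sand x y) (sand (neg x) z)) u =
      sand (toSCLSig.sor x (sand z u)) (toSCLSig.sor (neg x) (sand y u))

namespace EqMSCL

variable {M : Type*} (A : EqMSCL M)

theorem sor_F (x : M) : A.sor x A.F = x := by
  simp only [SCLSig.sor, SCLSig.F, A.neg_neg, A.sand_T]

theorem sor_sand_self (x y : M) : A.sor x (A.sand x y) = x := by
  have h := A.mscl1 (A.neg x) (A.neg y)
  simp only [SCLSig.sor, A.neg_neg] at h ⊢
  rw [h, A.neg_neg]

theorem sand_eq_sand_sor (x y : M) : A.sand x y = A.sand x (A.sor (A.neg x) y) := by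
  have h := A.mscl4 x A.T A.F y
  rwa [A.sand_T, ← A.sand_F, sor_sand_self, A.F_sand, sor_F, A.T_sand] at h

end EqMSCL

/-- In any EqMSCL-algebra: `x ∧· ¬x = x ∧· F` and `x ∧· y = x ∧· (¬x ∨· y)`. -/
theorem EqMSCL.sand_neg_self_and_absorb {M : Type*} (A : EqMSCL M) (x y : M) :
    A.sand x (A.neg x) = A.sand x A.F ∧
    A.sand x y = A.sand x (A.sor (A.neg x) y) :=
  ⟨by rw [A.sand_eq_sand_sor x A.F, A.sor_F], A.sand_eq_sand_sor x y⟩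
end

section
/- In any EqMSCL-algebra, the memory property holds: for all x, y, x ∧· (y ∧· x) = x ∧· y; in particular, x ∧· x = x. -/
namespace EqMSCL
variable {M : Type*} (A : EqMSCL M)

theorem neg_F : A.neg A.F = A.T := A.neg_neg A.T

theorem sand_self (x : M) : A.sand x x = x := by
  simpa only [sor_F] using A.mscl1 x A.F

theorem sor_self (x : M) : A.sor x x = x := by
  simp only [SCLSig.sor, sand_self, A.neg_neg]

theorem sand_F_sand (x u : M) : A.sand (A.sand x A.F) u = A.sand x A.F := by
  rw [A.sand_assoc, A.F_sand]

theorem sand_neg_self (x : M) : A.sand x (A.neg x) = A.sand x A.F := by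
  have h := A.mscl4 x A.F A.F A.T
  rw [← A.sand_F x, sor_self, sand_F_sand, A.F_sand, sor_F, sor_F] at h
  exact h.symm

theorem neg_sor_self (x : M) : A.sor (A.neg x) x = A.sor x A.T := by
  simp only [SCLSig.sor, A.neg_neg, sand_neg_self]
  exact congrArg A.neg (A.sand_F x)

theorem sand_neg_sor (x y : M) : A.sand x (A.sor (A.neg x) y) = A.sand x y := by
  have h := A.mscl4 x y A.F A.T
  rw [← A.sand_F x, ← A.mscl2, sor_F, A.F_sand, sor_F, A.sand_T, A.sand_T] at h
  exact h.symm

theorem sor_sand (x y z : M) :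
    A.sor x (A.sand y z) = A.sand (A.sor x y) (A.sor x z) := by
  have h := congrArg A.neg (A.mscl2 (A.neg x) (A.neg y) (A.neg z))
  simpa only [SCLSig.sor, A.neg_neg] using h

theorem sand_sand_sor_T (x y : M) :
    A.sand (A.sand x y) (A.sor x A.T) = A.sand x y := by
  rw [← sand_neg_sor A x y, A.sand_assoc, ← A.mscl3, ← A.sand_assoc, A.mscl1]

end EqMSCL

/-- The memory property: `x ∧· (y ∧· x) = x ∧· y`; in particular `x ∧· x = x`. -/
theorem EqMSCL.memory {M : Type*} (A : EqMSCL M) (x y : M) :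
    A.sand x (A.sand y x) = A.sand x y ∧ A.sand x x = x := by
  refine ⟨?_, A.sand_self x⟩
  rw [← A.sand_neg_sor x (A.sand y x), A.sor_sand, ← A.sand_assoc, A.sand_neg_sor,
    A.neg_sor_self, A.sand_sand_sor_T]
end

section
/- In any EqMSCL-algebra, for all x, y, z: (x ∧· y) ∨· z = (x ∧· (y ∨· z)) ∨· (¬x ∧· z). -/
namespace EqMSCL

variable {M : Type*} (A : EqMSCL M)

theorem neg_sor (x y : M) : A.neg (A.sor x y) = A.sand (A.neg x) (A.neg y) :=
  A.neg_neg _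

theorem neg_sand (x y : M) : A.neg (A.sand x y) = A.sor (A.neg x) (A.neg y) := by
  simp only [SCLSig.sor, A.neg_neg]

theorem F_sor (x : M) : A.sor A.F x = x := by
  simp only [SCLSig.sor, SCLSig.F, A.neg_neg, A.T_sand]

/-- The conditional in disjunctive form equals its conjunctive form. -/
theorem cond_eq (x y z : M) :
    A.sor (A.sand x y) (A.sand (A.neg x) z) = A.sand (A.sor x z) (A.sor (A.neg x) y) := by
  simpa only [A.sand_T] using A.mscl4 x y z A.T

/-- Conjunction distributes from the right over the conditional. -/
theorem cond_sand (x y z u : M) :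
    A.sand (A.sor (A.sand x y) (A.sand (A.neg x) z)) u =
      A.sor (A.sand x (A.sand y u)) (A.sand (A.neg x) (A.sand z u)) := by
  rw [A.mscl4, A.cond_eq]

/-- Negation distributes over the branches of the conditional. -/
theorem neg_cond (x y z : M) :
    A.neg (A.sor (A.sand x y) (A.sand (A.neg x) z)) =
      A.sor (A.sand x (A.neg y)) (A.sand (A.neg x) (A.neg z)) := by
  rw [A.neg_sor, A.neg_sand, A.neg_sand, A.neg_neg, A.cond_eq, A.mscl3]

/-- Disjunction distributes from the right over the conditional. -/
theorem cond_sor (x y z u : M) :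
    A.sor (A.sor (A.sand x y) (A.sand (A.neg x) z)) u =
      A.sor (A.sand x (A.sor y u)) (A.sand (A.neg x) (A.sor z u)) := by
  rw [← A.neg_neg (A.sor _ u), A.neg_sor, A.neg_cond, A.cond_sand, A.neg_cond]
  rfl

/-- A conjunction is a conditional whose second branch is `F`. -/
theorem sand_eq_cond (x y : M) :
    A.sor (A.sand x y) (A.sand (A.neg x) A.F) = A.sand x y := by
  rw [← A.sand_F, ← A.mscl2, A.sor_F]

end EqMSCL

/-- In any EqMSCL-algebra: `(x ∧· y) ∨· z = (x ∧· (y ∨· z)) ∨· (¬x ∧· z)`. -/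
theorem EqMSCL.sor_expand {M : Type*} (A : EqMSCL M) (x y z : M) :
    A.sor (A.sand x y) z =
      A.sor (A.sand x (A.sor y z)) (A.sand (A.neg x) z) := by
  rw [← A.sand_eq_cond x y, A.cond_sor, A.F_sor]
end

section
/- In any EqSSCL-algebra, for all x, y: x ∧· ¬x = F; x ∧· (y ∧· ¬x) = F; and left-sequential conjunction is commutative: x ∧· y = y ∧· x. -/
/-- An EqSSCL-algebra: an EqMSCL-algebra additionally satisfying `x ∧· F = F`. -/
structure EqSSCL (M : Type*) extends EqMSCL M where
  sand_F_eq_F : ∀ x, sand x toSCLSig.F = toSCLSig.F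

namespace EqSSCL
variable {M : Type*} (A : EqSSCL M)

theorem neg_F : A.neg A.F = A.T := A.neg_neg A.T

theorem sor_F (x : M) : A.sor x A.F = x := by
  simp only [SCLSig.sor, A.neg_F, A.sand_T, A.neg_neg]

theorem sand_neg_sor (x u : M) : A.sand x (A.sor (A.neg x) u) = A.sand x u := by
  have h := A.mscl4 x A.T A.F u
  rw [A.sand_T, A.sand_F_eq_F, A.sor_F, A.F_sand, A.sor_F, A.T_sand] at h
  exact h.symm

theorem sand_neg_self (x : M) : A.sand x (A.neg x) = A.F := by
  rw [← A.sor_F (A.neg x), A.sand_neg_sor, A.sand_F_eq_F]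

theorem sor_neg_self (x : M) : A.sor x (A.neg x) = A.T := by
  rw [SCLSig.sor, A.sand_neg_self, A.neg_F]

theorem neg_sor_sand (x y : M) : A.sand (A.sor (A.neg x) y) x = A.sand x y := by
  have h := A.mscl3 x A.F y
  rw [A.sor_F, A.sand_neg_sor] at h
  exact h.symm

theorem sand_sand_neg (x y : M) : A.sand x (A.sand y (A.neg x)) = A.F := by
  rw [← A.sand_assoc, ← A.neg_sor_sand x y, A.sand_assoc, A.sand_neg_self, A.sand_F_eq_F]

theorem neg_sand_sand (x y : M) : A.sand (A.neg x) (A.sand y x) = A.F := by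
  simpa only [A.neg_neg] using A.sand_sand_neg (A.neg x) y

theorem sor_neg_sand (x u : M) : A.sor x (A.sand (A.neg x) u) = A.sor x u := by
  simpa only [SCLSig.sor, A.neg_neg] using
    congrArg A.neg (A.sand_neg_sor (A.neg x) (A.neg u))

theorem sor_sand_self (x y : M) : A.sor x (A.sand y x) = x := by
  rw [← A.sor_neg_sand, A.neg_sand_sand, A.sor_F]

theorem sand_sand_self (x y : M) : A.sand x (A.sand y x) = A.sand x y := by
  have h := A.mscl2 (A.sand x y) x (A.neg x)
  rw [A.sor_neg_self, A.sand_T, A.sand_assoc, A.sand_assoc, A.sand_sand_neg, A.sor_F] at h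
  exact h.symm

theorem sor_sand_neg_sor (x u : M) : A.sand (A.sor x u) (A.sor (A.neg x) u) = u := by
  have h := A.mscl4 x A.T A.T u
  rw [A.sand_T, A.sand_T, A.sor_neg_self, A.T_sand] at h
  exact h.symm

theorem sand_sand_self_left (x y : M) : A.sand x (A.sand y x) = A.sand y x := by
  have h := A.sor_sand_neg_sor x (A.sand y x)
  rwa [A.sor_sand_self, A.sand_neg_sor] at h

end EqSSCL

/-- In any EqSSCL-algebra: `x ∧· ¬x = F`, `x ∧· (y ∧· ¬x) = F`, and
left-sequential conjunction is commutative. -/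
theorem EqSSCL.comm {M : Type*} (A : EqSSCL M) (x y : M) :
    A.sand x (A.neg x) = A.F ∧
    A.sand x (A.sand y (A.neg x)) = A.F ∧
    A.sand x y = A.sand y x :=
  ⟨A.sand_neg_self x, A.sand_sand_neg x y,
    (A.sand_sand_self x y).symm.trans (A.sand_sand_self_left x y)⟩
end

section
/- In any CPstat-algebra, the following hold for all x, y, z, u, v, w: the memorizing axiom x ◁ y ▷ (z ◁ u ▷ (v ◁ y ▷ w)) = x ◁ y ▷ (z ◁ u ▷ w); the identity v ◁ y ▷ v = v (hence F ◁ x ▷ F = F); and commutativity of left-sequential conjunction, x ∧· y = y ∧· x. -/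
/-- A CPstat-algebra: a type with constants `T`, `F` and Hoare's ternary conditional
`cond x y z` (written `x ◁ y ▷ z`) satisfying (CP1)–(CP4), (CPstat) and the
contraction law. -/
structure CPstatAlg (M : Type*) where
  T : M
  F : M
  cond : M → M → M → M
  cp1 : ∀ x y, cond x T y = x
  cp2 : ∀ x y, cond x F y = y
  cp3 : ∀ x, cond T x F = x
  cp4 : ∀ x y z u v, cond x (cond y z u) v = cond (cond x y v) z (cond x u v)
  cpstat : ∀ x y z u v,
    cond (cond x y z) u v = cond (cond x u v) y (cond z u v)
  contr : ∀ x y v w, cond x y (cond v y w) = cond x y w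

namespace CPstatAlg
variable {M : Type*}
/-- Negation: `¬x = F ◁ x ▷ T`. -/
def neg (A : CPstatAlg M) (x : M) : M := A.cond A.F x A.T
/-- Left-sequential conjunction: `x ∧· y = y ◁ x ▷ F`. -/
def sand (A : CPstatAlg M) (x y : M) : M := A.cond y x A.F
end CPstatAlg

namespace CPstatAlg
variable {M : Type*} (A : CPstatAlg M)

theorem cond_self (v y : M) : A.cond v y v = v := by
  simpa only [A.cp2] using (A.cpstat A.T y A.T A.F v).symm

theorem cond_neg (x u v : M) : A.cond x (A.neg u) v = A.cond v u x := by
  rw [neg, A.cp4, A.cp1, A.cp2]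

/-- The mirror image of `cpstat`, for a conditional in the right-hand argument. -/
theorem cond_cond_right (z u v y w : M) :
    A.cond z u (A.cond v y w) = A.cond (A.cond z u v) y (A.cond z u w) := by
  simpa only [cond_neg] using A.cpstat v y w (A.neg u) z

theorem cond_memorizing (x y z u v w : M) :
    A.cond x y (A.cond z u (A.cond v y w)) = A.cond x y (A.cond z u w) := by
  rw [cond_cond_right A z, A.contr]

theorem sand_comm (x y : M) : A.sand x y = A.sand y x := by
  have h := A.cpstat A.T y A.F x A.F
  rwa [A.cp3, A.cp3, cond_self] at h

end CPstatAlg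

/-- In any CPstat-algebra: the memorizing axiom
`x ◁ y ▷ (z ◁ u ▷ (v ◁ y ▷ w)) = x ◁ y ▷ (z ◁ u ▷ w)` holds; the identity
`v ◁ y ▷ v = v` holds (hence `F ◁ x ▷ F = F`); and left-sequential conjunction
is commutative. -/
theorem CPstatAlg.mem_and_diag_and_comm {M : Type*} (A : CPstatAlg M) :
    (∀ x y z u v w,
      A.cond x y (A.cond z u (A.cond v y w)) = A.cond x y (A.cond z u w)) ∧
    (∀ v y, A.cond v y v = v) ∧
    (∀ x, A.cond A.F x A.F = A.F) ∧
    (∀ x y, A.sand x y = A.sand y x) :=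
  ⟨A.cond_memorizing, A.cond_self, A.cond_self A.F, A.sand_comm⟩
end

section
/- In any CPstat*-algebra, distributivity holds: for all x, y, z, x ∨· (y ∧· z) = (x ∨· y) ∧· (x ∨· z); moreover the static axioms are derivable: (x ◁ y ▷ z) ◁ u ▷ v = (x ◁ u ▷ v) ◁ y ▷ (z ◁ u ▷ v) and (x ◁ y ▷ z) ◁ y ▷ u = x ◁ y ▷ u. -/
/-- A CPstat*-algebra: a type with constants `T`, `F` and Hoare's ternary
conditional `cond x y z` (written `x ◁ y ▷ z`) satisfying (CP1), (CP2),
(CP3*), (CP4) and (CP5). -/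
structure CPstatStarAlg (M : Type*) where
  T : M
  F : M
  cond : M → M → M → M
  cp1 : ∀ x y, cond x T y = x
  cp2 : ∀ x y, cond x F y = y
  cp3star : ∀ x y, cond T x y = cond T y x
  cp4 : ∀ x y z u v, cond x (cond y z u) v = cond (cond x y v) z (cond x u v)
  cp5 : ∀ x y z, cond (cond x y z) y F = cond x y F

namespace CPstatStarAlg
variable {M : Type*}
/-- Negation: `¬x = F ◁ x ▷ T`. -/
def neg (A : CPstatStarAlg M) (x : M) : M := A.cond A.F x A.T
/-- Left-sequential conjunction: `x ∧· y = y ◁ x ▷ F`. -/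
def sand (A : CPstatStarAlg M) (x y : M) : M := A.cond y x A.F
/-- Left-sequential disjunction: `x ∨· y = ¬(¬x ∧· ¬y)`. -/
def sor (A : CPstatStarAlg M) (x y : M) : M := A.neg (A.sand (A.neg x) (A.neg y))
end CPstatStarAlg

namespace CPstatStarAlg
variable {M : Type*} (A : CPstatStarAlg M)

theorem cond_T_F (x : M) : A.cond A.T x A.F = x := by
  rw [A.cp3star, A.cp2]

theorem cond_neg (x y z : M) : A.cond x (A.neg y) z = A.cond z y x := by
  rw [neg, A.cp4, A.cp1, A.cp2]

theorem neg_neg (x : M) : A.neg (A.neg x) = x := by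
  rw [neg, cond_neg, cond_T_F]

theorem neg_cond (x y z : M) :
    A.neg (A.cond x y z) = A.cond (A.neg x) y (A.neg z) :=
  A.cp4 _ _ _ _ _

theorem neg_T : A.neg A.T = A.F := A.cp1 _ _

theorem neg_F : A.neg A.F = A.T := A.cp2 _ _

theorem sor_eq_cond (x y : M) : A.sor x y = A.cond A.T x y := by
  rw [sor, sand, cond_neg, neg_cond, neg_neg, neg_F]

theorem sand_comm (x y : M) : A.sand x y = A.sand y x := by
  have h (a b : M) : A.sand a b = A.neg (A.cond A.T (A.neg a) (A.neg b)) := by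
    rw [cond_neg, neg_cond, neg_neg, neg_T, sand]
  rw [h, h, A.cp3star]

theorem sand_neg (x y : M) : A.sand (A.neg x) y = A.cond A.F x y :=
  A.cond_neg _ _ _

theorem sand_cond_self (x y z : M) : A.sand y (A.cond x y z) = A.sand y x :=
  A.cp5 _ _ _

theorem sand_neg_cond_self (x y z : M) :
    A.sand (A.neg y) (A.cond x y z) = A.sand (A.neg y) z := by
  rw [← cond_neg, sand_cond_self]

theorem sand_cond (w x y z : M) :
    A.sand w (A.cond x y z) = A.cond (A.sand w x) y (A.sand w z) := by
  rw [sand_comm, sand, A.cp4, ← sand, ← sand, sand_comm, A.sand_comm z]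

theorem cond_T_cond_self (x y z : M) :
    A.cond A.T y (A.cond x y z) = A.cond A.T y z := by
  have h := congrArg A.neg (A.sand_neg_cond_self (A.neg x) y (A.neg z))
  simpa only [sand_neg, neg_cond, neg_neg, neg_F] using h

theorem cond_F_self_F (x : M) : A.cond A.F x A.F = A.F := by
  change A.sand x A.F = A.F
  rw [sand_comm, sand, A.cp2]

theorem cond_T_self_T (x : M) : A.cond A.T x A.T = A.T := by
  have h := congrArg A.neg (A.cond_F_self_F x)
  simpa only [neg_cond, neg_F] using h

/-- Excluded middle. -/
theorem cond_T_neg (x : M) : A.cond A.T x (A.neg x) = A.T := by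
  rw [neg, cond_T_cond_self, cond_T_self_T]

/-- Absorption. -/
theorem cond_T_sand (x y : M) : A.cond A.T x (A.sand y x) = x := by
  rw [sand_comm, sand, cond_T_cond_self, cond_T_F]

theorem cond_sand_neg (x y : M) : A.cond x y (A.sand (A.neg y) x) = x := by
  have h := A.cp4 x A.T y (A.neg y) A.F
  rw [cond_T_neg, A.cp1] at h
  exact h.symm

theorem sand_sor_sand_neg (x y : M) :
    A.cond A.T (A.sand y x) (A.sand (A.neg y) x) = x := by
  rw [show A.sand y x = A.cond x y A.F from rfl, A.cp4, A.cp2, cond_T_sand, cond_sand_neg]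

theorem eq_of_sand_eq {x y : M} (z : M) (h : A.sand z x = A.sand z y)
    (h' : A.sand (A.neg z) x = A.sand (A.neg z) y) : x = y := by
  rw [← A.sand_sor_sand_neg x z, h, h', sand_sor_sand_neg]

theorem cond_cond_self_left (x y z u : M) :
    A.cond (A.cond x y z) y u = A.cond x y u := by
  apply A.eq_of_sand_eq y
  · simp only [sand_cond_self]
  · simp only [sand_neg_cond_self]

theorem cond_cond_self_right (x y z u : M) :
    A.cond x y (A.cond z y u) = A.cond x y u := by
  apply A.eq_of_sand_eq y
  · simp only [sand_cond_self]
  · simp only [sand_neg_cond_self]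

theorem cond_cond_left (x y z u v : M) :
    A.cond (A.cond x y z) u v = A.cond (A.cond x u v) y (A.cond z u v) := by
  apply A.eq_of_sand_eq y
  · rw [sand_cond_self, sand_cond, sand_cond_self, ← sand_cond]
  · rw [sand_neg_cond_self, sand_cond, sand_neg_cond_self, ← sand_cond]

theorem sor_sand (x y z : M) :
    A.sor x (A.sand y z) = A.sand (A.sor x y) (A.sor x z) := by
  simp only [sor_eq_cond, sand]
  rw [A.cp4, A.cp1, cond_cond_self_left, A.cond_cond_left A.T x z,
    cond_cond_self_right]

end CPstatStarAlg

/-- In any CPstat*-algebra, distributivity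
`x ∨· (y ∧· z) = (x ∨· y) ∧· (x ∨· z)` holds, and the static axioms
`(x ◁ y ▷ z) ◁ u ▷ v = (x ◁ u ▷ v) ◁ y ▷ (z ◁ u ▷ v)` and
`(x ◁ y ▷ z) ◁ y ▷ u = x ◁ y ▷ u` are derivable. -/
theorem CPstatStarAlg.distrib_and_static {M : Type*} (A : CPstatStarAlg M) :
    (∀ x y z, A.sor x (A.sand y z) = A.sand (A.sor x y) (A.sor x z)) ∧
    (∀ x y z u v,
      A.cond (A.cond x y z) u v = A.cond (A.cond x u v) y (A.cond z u v)) ∧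
    (∀ x y z u, A.cond (A.cond x y z) y u = A.cond x y u) :=
  ⟨A.sor_sand, A.cond_cond_left, A.cond_cond_self_left⟩
end
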